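/- Let ⋆ be a semistar operation on an integral domain D. The following are equivalent: (1) D is a ⋆̃-stably strong S-domain; (2) the localization D_P is a stably strong S-domain for every quasi-⋆̃-prime ideal P of D; (3) the localization D_M is a stably strong S-domain for every quasi-⋆̃-maximal ideal M of D. -/

import Mathlib

/- ## Preliminaries: general ideal-chain notions in a commutative ring -/

open Pointwise

section ChainNotions

variable {A B : Type*} [CommRing A] [CommRing B]

/-- `P` and `Q` are adjacent with respect to the class `Φ` of ideals:
`P ⊂ Q` and no ideal of the class `Φ` lies strictly between them. -/
def AdjacentFor (Φ : Ideal A → Prop) (P Q : Ideal A) : Prop :=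
  P < Q ∧ ∀ I : Ideal A, Φ I → ¬(P < I ∧ I < Q)

/-- A saturated chain, consisting of ideals of the class `Φ`, of length `m`
between `P` and `Q` (saturated: consecutive members are `Φ`-adjacent). -/
def SaturatedChainFor (Φ : Ideal A → Prop) (P Q : Ideal A) (m : ℕ) : Prop :=
  ∃ c : Fin (m + 1) → Ideal A, StrictMono c ∧ c 0 = P ∧ c (Fin.last m) = Q ∧
    (∀ i, Φ (c i)) ∧ ∀ i : Fin m, AdjacentFor Φ (c i.castSucc) (c i.succ)

/-- Catenarity with respect to the class `Φ` of ideals: for every pair `P ⊂ Q` of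
`Φ`-ideals, any two saturated chains of `Φ`-ideals between `P` and `Q` have the
same (finite) length. -/
def CatenaryFor (Φ : Ideal A → Prop) : Prop :=
  ∀ P Q : Ideal A, Φ P → Φ Q → P < Q →
    ∀ m₁ m₂ : ℕ, SaturatedChainFor Φ P Q m₁ → SaturatedChainFor Φ P Q m₂ → m₁ = m₂

/-- A chain `(0) = P₀ ⊂ P₁ ⊂ ⋯ ⊂ Pₙ` with all `Pᵢ`, `1 ≤ i ≤ n`, in the class `Φ`. -/
def DimChainFor (Φ : Ideal A → Prop) (n : ℕ) : Prop :=
  ∃ c : Fin (n + 1) → Ideal A, StrictMono c ∧ c 0 = ⊥ ∧ ∀ i, i ≠ 0 → Φ (c i)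

/-- The dimension associated to the class `Φ` of (quasi-prime) ideals: the supremum of
the lengths of chains `(0) = P₀ ⊂ P₁ ⊂ ⋯ ⊂ Pₙ` with all `Pᵢ` (`i ≥ 1`) in `Φ`. -/
noncomputable def quasiDim (Φ : Ideal A → Prop) : ℕ∞ :=
  ⨆ (n : ℕ) (_ : DimChainFor Φ n), (n : ℕ∞)

/-- The height of an ideal `P`: the supremum of lengths of strict chains of prime
ideals ending at `P`. -/
noncomputable def idealHeight (P : Ideal A) : ℕ∞ :=
  ⨆ (n : ℕ) (_ : ∃ c : Fin (n + 1) → Ideal A, StrictMono c ∧ (∀ i, (c i).IsPrime) ∧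
      c (Fin.last n) = P), (n : ℕ∞)

/-- The Krull dimension of a commutative ring, as the supremum in `ℕ∞` of the lengths
of strict chains of prime ideals. -/
noncomputable def krullDimE (A : Type*) [CommRing A] : ℕ∞ :=
  ⨆ (n : ℕ) (_ : ∃ c : Fin (n + 1) → Ideal A, StrictMono c ∧ ∀ i, (c i).IsPrime), (n : ℕ∞)

/-- Every pair of `Φ`-adjacent `Φ`-ideals `P ⊂ Q` of `A` extends, along `f : A →+* B`,
to a pair of `Ψ`-adjacent `Ψ`-ideals `P.map f ⊂ Q.map f` of `B`. -/
def ExtendsAdjacent (f : A →+* B) (Φ : Ideal A → Prop) (Ψ : Ideal B → Prop) : Prop :=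
  ∀ P Q : Ideal A, Φ P → Φ Q → AdjacentFor Φ P Q →
    Ψ (Ideal.map f P) ∧ Ψ (Ideal.map f Q) ∧ AdjacentFor Ψ (Ideal.map f P) (Ideal.map f Q)

/-- A (classically) catenary ring: any two saturated chains of primes between a fixed
pair of primes `P ⊂ Q` have the same finite length. -/
def IsCatenaryRing (A : Type*) [CommRing A] : Prop :=
  CatenaryFor (fun I : Ideal A => I.IsPrime)

/-- A (classical) S-domain: every height-one prime `P` extends to a height-one prime
`P[X]` of the polynomial ring. -/
def IsSDomain (A : Type*) [CommRing A] : Prop :=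
  ∀ P : Ideal A, P.IsPrime → idealHeight P = 1 →
    idealHeight (Ideal.map (Polynomial.C : A →+* Polynomial A) P) = 1

/-- A (classical) strong S-domain: every pair of adjacent primes `P ⊂ Q` extends to a
pair of adjacent primes `P[X] ⊂ Q[X]` of the polynomial ring. -/
def IsStrongSDomain (A : Type*) [CommRing A] : Prop :=
  ExtendsAdjacent (Polynomial.C : A →+* Polynomial A)
    (fun I : Ideal A => I.IsPrime) (fun I : Ideal (Polynomial A) => I.IsPrime)

/-- A (classical) stably strong S-domain: `A[X₁,…,Xₙ]` is a strong S-domain for all `n ≥ 1`. -/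
def IsStablyStrongSDomain (A : Type*) [CommRing A] : Prop :=
  ∀ n : ℕ, 1 ≤ n → IsStrongSDomain (MvPolynomial (Fin n) A)

/-- A (classical) Jaffard domain: finite Krull dimension, and
`dim (A[X₁,…,Xₙ]) = dim A + n` for all `n ≥ 1`. -/
def IsJaffardDomain (A : Type*) [CommRing A] : Prop :=
  krullDimE A ≠ ⊤ ∧ ∀ n : ℕ, 1 ≤ n → krullDimE (MvPolynomial (Fin n) A) = krullDimE A + n

end ChainNotions

/- ## Semistar operations -/

section Semistar

variable (R : Type*) (F : Type*) [CommRing R] [Field F] [Algebra R F]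

instance (priority := 100) : SMulCommClass F R F := SMulCommClass.symm R F F

/-- A semistar operation on a domain `R` with quotient field `F`: an operation on the
(nonzero) `R`-submodules of `F` satisfying `(xE)^⋆ = x E^⋆`, monotonicity, extensivity
and idempotency. (The value on the zero submodule is irrelevant.) -/
structure SemistarOp where
  /-- the underlying map on `R`-submodules of `F` -/
  star : Submodule R F → Submodule R F
  star_smul : ∀ x : F, x ≠ 0 → ∀ E : Submodule R F, E ≠ ⊥ → star (x • E) = x • star E
  star_mono : ∀ E G : Submodule R F, E ≠ ⊥ → G ≠ ⊥ → E ≤ G → star E ≤ star G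
  le_star : ∀ E : Submodule R F, E ≠ ⊥ → E ≤ star E
  star_idem : ∀ E : Submodule R F, E ≠ ⊥ → star (star E) = star E

variable {R F}

/-- The extension of an ideal of `R` to an `R`-submodule of `F`. -/
def idealExt (I : Ideal R) : Submodule R F := Submodule.map (Algebra.linearMap R F) I

/-- The contraction to `R` of an `R`-submodule of `F` (i.e. `E ∩ R`). -/
def idealCon (E : Submodule R F) : Ideal R := Submodule.comap (Algebra.linearMap R F) E

/-- The finite-type semistar operation `⋆_f` associated to `⋆`:
`E^{⋆_f}` is the union of `G^⋆` over all nonzero finitely generated `G ⊆ E`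
(the family is directed, so the union is the supremum). -/
noncomputable def SemistarOp.ft (s : SemistarOp R F) (E : Submodule R F) : Submodule R F :=
  ⨆ (G : Submodule R F) (_ : G.FG ∧ G ≠ ⊥ ∧ G ≤ E), s.star G

/-- `I` is a quasi-`f`-ideal (for `f` a semistar-type operation, e.g. `s.star`, `s.ft`
or `s.tilde`): `I` is nonzero and `f(I) ∩ R = I`. -/
def IsQuasiIdeal (f : Submodule R F → Submodule R F) (I : Ideal R) : Prop :=
  I ≠ ⊥ ∧ idealCon (f (idealExt I)) = I

/-- A quasi-prime: a prime quasi-ideal. -/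
def IsQuasiPrime (f : Submodule R F → Submodule R F) (I : Ideal R) : Prop :=
  I.IsPrime ∧ IsQuasiIdeal f I

/-- A quasi-maximal ideal: maximal among proper quasi-ideals. -/
def IsQuasiMax (f : Submodule R F → Submodule R F) (I : Ideal R) : Prop :=
  IsQuasiIdeal f I ∧ I ≠ ⊤ ∧ ∀ J : Ideal R, IsQuasiIdeal f J → J ≠ ⊤ → I ≤ J → I = J

/-- The stable finite-type semistar operation `⋆̃` associated to `⋆`:
`E^{⋆̃} = ⋂ { E R_P : P a quasi-⋆_f-maximal ideal }`, where
`x ∈ E R_P ↔ ∃ d ∉ P, d • x ∈ E` (each quasi-⋆_f-maximal ideal is prime); if there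
is no quasi-⋆_f-maximal ideal, `E^{⋆̃} = F`. -/
def SemistarOp.tilde (s : SemistarOp R F) (E : Submodule R F) : Submodule R F where
  carrier := {x : F | ∀ P : Ideal R, IsQuasiMax s.ft P → P.IsPrime →
    ∃ d : R, d ∉ P ∧ d • x ∈ E}
  zero_mem' := by
    intro P _ hP
    exact ⟨1, fun h => hP.ne_top ((Ideal.eq_top_iff_one P).mpr h), by simp⟩
  add_mem' := by
    intro x y hx hy P hPmax hP
    obtain ⟨d₁, hd₁, hdx⟩ := hx P hPmax hP
    obtain ⟨d₂, hd₂, hdy⟩ := hy P hPmax hP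
    refine ⟨d₁ * d₂, fun h => (hP.mem_or_mem h).elim hd₁ hd₂, ?_⟩
    have h₁ : (d₁ * d₂) • x ∈ E := by rw [mul_comm, mul_smul]; exact E.smul_mem d₂ hdx
    have h₂ : (d₁ * d₂) • y ∈ E := by rw [mul_smul]; exact E.smul_mem d₁ hdy
    simpa [smul_add] using E.add_mem h₁ h₂
  smul_mem' := by
    intro r x hx P hPmax hP
    obtain ⟨d, hd, hdx⟩ := hx P hPmax hP
    refine ⟨d, hd, ?_⟩
    rw [smul_smul, mul_comm, ← smul_smul]
    exact E.smul_mem r hdx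

/-- The characterization of the quasi-`⋆[n]`-prime ideals of `R[n] = R[X₁,…,Xₙ]` for the
iterated Nagata-type (stable, finite-type) semistar operation `⋆[n]` on `R[n]`:
a nonzero prime `Q` of `R[n]` is quasi-`⋆[n]`-prime iff `Q ∩ R = 0` or
`(Q ∩ R)^{⋆_f} ≠ R^⋆`. -/
def QuasiPolyPrime (s : SemistarOp R F) (n : ℕ) (Q : Ideal (MvPolynomial (Fin n) R)) : Prop :=
  Q ≠ ⊥ ∧ Q.IsPrime ∧
    (Ideal.comap (algebraMap R (MvPolynomial (Fin n) R)) Q = ⊥ ∨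
      s.ft (idealExt (Ideal.comap (algebraMap R (MvPolynomial (Fin n) R)) Q)) ≠
        s.star (idealExt (⊤ : Ideal R)))

/-- The `⋆̃`-dimension of `R`. -/
noncomputable def tildeDim (s : SemistarOp R F) : ℕ∞ := quasiDim (IsQuasiPrime s.tilde)

/-- The `⋆[n]`-dimension of `R[n] = R[X₁,…,Xₙ]`. -/
noncomputable def polyDim (s : SemistarOp R F) (n : ℕ) : ℕ∞ := quasiDim (QuasiPolyPrime s n)

/-- `R` is a `⋆̃`-S-domain: every height-one quasi-`⋆̃`-prime `P` extends to a height-one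
quasi-`⋆[1]`-prime `P[X₁]` of `R[X₁]`. -/
def TildeSDomain (s : SemistarOp R F) : Prop :=
  ∀ P : Ideal R, IsQuasiPrime s.tilde P → idealHeight P = 1 →
    QuasiPolyPrime s 1 (Ideal.map (algebraMap R (MvPolynomial (Fin 1) R)) P) ∧
    idealHeight (Ideal.map (algebraMap R (MvPolynomial (Fin 1) R)) P) = 1

/-- `R` is a `⋆̃`-strong S-domain: each pair of adjacent quasi-`⋆̃`-primes `P₁ ⊂ P₂`
extends to a pair of adjacent quasi-`⋆[1]`-primes `P₁[X₁] ⊂ P₂[X₁]` of `R[X₁]`. -/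
def TildeStrongSDomain (s : SemistarOp R F) : Prop :=
  ExtendsAdjacent (algebraMap R (MvPolynomial (Fin 1) R))
    (IsQuasiPrime s.tilde) (QuasiPolyPrime s 1)

/-- `R[n]` is a `⋆[n]`-strong S-domain: each pair of adjacent quasi-`⋆[n]`-primes
`Q₁ ⊂ Q₂` of `R[n]` extends to a pair of adjacent quasi-`⋆[n+1]`-primes
`Q₁[X_{n+1}] ⊂ Q₂[X_{n+1}]` of `R[n+1]`. -/
def PolyStrongSDomain (s : SemistarOp R F) (n : ℕ) : Prop :=
  ExtendsAdjacent (MvPolynomial.rename (Fin.castSucc : Fin n → Fin (n + 1))).toRingHom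
    (QuasiPolyPrime s n) (QuasiPolyPrime s (n + 1))

/-- `R` is a `⋆̃`-stably strong S-domain: `R[n]` is a `⋆[n]`-strong S-domain for all
`n ≥ 1`. -/
def TildeStablyStrongSDomain (s : SemistarOp R F) : Prop :=
  ∀ n : ℕ, 1 ≤ n → PolyStrongSDomain s n

/-- `R` is `⋆̃`-catenary. -/
def TildeCatenary (s : SemistarOp R F) : Prop := CatenaryFor (IsQuasiPrime s.tilde)

/-- `R[n]` is `⋆[n]`-catenary. -/
def PolyCatenary (s : SemistarOp R F) (n : ℕ) : Prop := CatenaryFor (QuasiPolyPrime s n)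

/-- `R` is `⋆̃`-universally catenarian: `R[n]` is `⋆[n]`-catenary for all `n ≥ 1`. -/
def TildeUnivCatenarian (s : SemistarOp R F) : Prop :=
  ∀ n : ℕ, 1 ≤ n → PolyCatenary s n

/-- `R` is a `⋆̃`-Jaffard domain. -/
def TildeJaffard (s : SemistarOp R F) : Prop :=
  tildeDim s ≠ ⊤ ∧ ∀ n : ℕ, 1 ≤ n → polyDim s n = tildeDim s + n

/-- `R` is `⋆̃`-Noetherian: ascending chain condition on quasi-`⋆̃`-ideals. -/
def TildeNoetherian (s : SemistarOp R F) : Prop :=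
  ∀ f : ℕ → Ideal R, (∀ i, IsQuasiIdeal s.tilde (f i)) → Monotone f →
    ∃ N : ℕ, ∀ m : ℕ, N ≤ m → f m = f N

/-- `R` is a `⋆̃`-quasi-Prüfer domain: every prime `Q` of `R[X]` with `Q ⊆ P[X]` for some
quasi-`⋆̃`-prime `P` of `R` satisfies `Q = (Q ∩ R)[X]`. -/
def TildeQuasiPrufer (s : SemistarOp R F) : Prop :=
  ∀ Q : Ideal (Polynomial R), Q.IsPrime →
    (∃ P : Ideal R, IsQuasiPrime s.tilde P ∧
      Q ≤ Ideal.map (Polynomial.C : R →+* Polynomial R) P) →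
    Q = Ideal.map (Polynomial.C : R →+* Polynomial R)
      (Ideal.comap (Polynomial.C : R →+* Polynomial R) Q)

/-- `R` is a Prüfer `⋆`-multiplication domain: `(I · (R :_F I))^{⋆_f} = R^⋆` for every
nonzero finitely generated ideal `I` of `R`. -/
def IsPStarMD (s : SemistarOp R F) : Prop :=
  ∀ I : Ideal R, I ≠ ⊥ → I.FG →
    s.ft (idealExt I * ((idealExt (⊤ : Ideal R) : Submodule R F) / idealExt I)) =
      s.star (idealExt (⊤ : Ideal R))

/-- An overring `T` of `R` (with semistar operation `⋆'`) is `(⋆,⋆')`-linked to `R`: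
for every nonzero finitely generated ideal `G` of `R`, `G^⋆ = R^⋆` implies
`(GT)^{⋆'} = T^{⋆'}`. -/
def IsLinkedOverring (s : SemistarOp R F) (T : Subalgebra R F) (s' : SemistarOp T F) : Prop :=
  ∀ G : Ideal R, G ≠ ⊥ → G.FG →
    s.star (idealExt G) = s.star (idealExt (⊤ : Ideal R)) →
      s'.star (idealExt (Ideal.map (algebraMap R T) G)) =
        s'.star (idealExt (⊤ : Ideal T))

/-- `R` is a `⋆̃`-going-down domain: for every overring `T` of `R` (a subring of `F`
containing `R`; note `F` is also the quotient field of `T`) and every semistar operation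
`⋆'` on `T`, the extension `R ⊆ T` satisfies `(⋆̃,⋆̃')`-GD. -/
def TildeGoingDown (s : SemistarOp R F) : Prop :=
  ∀ (T : Subalgebra R F) (s' : SemistarOp T F),
    ∀ P₀ P : Ideal R, IsQuasiPrime s.tilde P₀ → IsQuasiPrime s.tilde P → P₀ < P →
      ∀ Q : Ideal T, IsQuasiPrime s'.tilde Q → Ideal.comap (algebraMap R T) Q = P →
        ∃ Q₀ : Ideal T, IsQuasiPrime s'.tilde Q₀ ∧ Q₀ ≤ Q ∧
          Ideal.comap (algebraMap R T) Q₀ = P₀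

end Semistar

section AdjacentPrimes

variable {A B : Type*} [CommRing A] [CommRing B]

theorem isStrongSDomain_iff :
    IsStrongSDomain A ↔ ∀ P Q : Ideal A, P.IsPrime → Q.IsPrime →
      AdjacentFor Ideal.IsPrime P Q → AdjacentFor Ideal.IsPrime
        (P.map (Polynomial.C : A →+* Polynomial A)) (Q.map Polynomial.C) :=
  ⟨fun h P Q hP hQ hPQ ↦ (h P Q hP hQ hPQ).2.2, fun h P Q hP hQ hPQ ↦
    ⟨(Ideal.isPrime_map_C_iff_isPrime _).2 hP,
      (Ideal.isPrime_map_C_iff_isPrime _).2 hQ, h P Q hP hQ hPQ⟩⟩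

theorem comap_lt_comap_iff_of_map_comap {f : A →+* B}
    (hf : ∀ J : Ideal B, (J.comap f).map f = J) {P Q : Ideal B} :
    P.comap f < Q.comap f ↔ P < Q := by
  have key (I J : Ideal B) : I.comap f ≤ J.comap f ↔ I ≤ J :=
    ⟨fun h ↦ by simpa only [hf] using Ideal.map_mono (f := f) h, fun h ↦ Ideal.comap_mono h⟩
  rw [lt_iff_le_not_ge, lt_iff_le_not_ge, key, key]

theorem adjacentFor_comap_iff {f : A →+* B} (hf : ∀ J : Ideal B, (J.comap f).map f = J)
    {P Q : Ideal B}
    (h : ∀ I : Ideal A, I.IsPrime → P.comap f ≤ I → I ≤ Q.comap f →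
      ∃ J : Ideal B, J.IsPrime ∧ J.comap f = I) :
    AdjacentFor Ideal.IsPrime (P.comap f) (Q.comap f) ↔ AdjacentFor Ideal.IsPrime P Q := by
  refine and_congr (comap_lt_comap_iff_of_map_comap hf) ⟨fun H J hJ hlt ↦ ?_, fun H I hI hlt ↦ ?_⟩
  · exact H _ (hJ.comap f) ⟨(comap_lt_comap_iff_of_map_comap hf).2 hlt.1,
      (comap_lt_comap_iff_of_map_comap hf).2 hlt.2⟩
  · obtain ⟨J, hJ, rfl⟩ := h I hI hlt.1.le hlt.2.le
    exact H J hJ ⟨(comap_lt_comap_iff_of_map_comap hf).1 hlt.1,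
      (comap_lt_comap_iff_of_map_comap hf).1 hlt.2⟩

theorem adjacentFor_comap_iff_of_surjective {f : A →+* B} (hf : Function.Surjective f)
    {P Q : Ideal B} :
    AdjacentFor Ideal.IsPrime (P.comap f) (Q.comap f) ↔ AdjacentFor Ideal.IsPrime P Q := by
  refine adjacentFor_comap_iff (Ideal.map_comap_of_surjective f hf) fun I hI hPI _ ↦ ?_
  have hker : RingHom.ker f ≤ I := (Ideal.comap_mono bot_le).trans hPI
  refine ⟨I.map f, Ideal.map_isPrime_of_surjective hf hker, ?_⟩
  rw [Ideal.comap_map_of_surjective f hf]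
  exact sup_eq_left.2 hker

theorem adjacentFor_comap_algebraMap_iff [Algebra A B] (S : Submonoid A) [IsLocalization S B]
    {P Q : Ideal B} [Q.IsPrime] :
    AdjacentFor Ideal.IsPrime (P.comap (algebraMap A B)) (Q.comap (algebraMap A B)) ↔
      AdjacentFor Ideal.IsPrime P Q := by
  refine adjacentFor_comap_iff (IsLocalization.map_under S B) fun I hI _ hIQ ↦ ?_
  have hd : Disjoint (S : Set A) I :=
    ((IsLocalization.isPrime_iff_isPrime_disjoint S B Q).1 inferInstance).2.mono_right hIQ
  exact ⟨I.map (algebraMap A B), IsLocalization.isPrime_of_isPrime_disjoint S B I hI hd,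
    IsLocalization.under_map_of_isPrime_disjoint S B hI hd⟩

theorem comap_mapRingHom_map_C (f : A →+* B) (P : Ideal B) :
    (P.map Polynomial.C).comap (Polynomial.mapRingHom f) = (P.comap f).map Polynomial.C := by
  ext p
  simp [Ideal.mem_map_C_iff]

theorem adjacentFor_map_C_comap_iff_of_surjective {f : A →+* B} (hf : Function.Surjective f)
    {P Q : Ideal B} :
    AdjacentFor Ideal.IsPrime ((P.comap f).map Polynomial.C) ((Q.comap f).map Polynomial.C) ↔
      AdjacentFor Ideal.IsPrime (P.map Polynomial.C) (Q.map Polynomial.C) := by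
  rw [← comap_mapRingHom_map_C, ← comap_mapRingHom_map_C]
  exact adjacentFor_comap_iff_of_surjective (Polynomial.map_surjective f hf)

theorem adjacentFor_map_C_comap_algebraMap_iff [Algebra A B] (S : Submonoid A)
    [IsLocalization S B] {P Q : Ideal B} [hQ : Q.IsPrime] :
    AdjacentFor Ideal.IsPrime ((P.comap (algebraMap A B)).map Polynomial.C)
        ((Q.comap (algebraMap A B)).map Polynomial.C) ↔
      AdjacentFor Ideal.IsPrime (P.map Polynomial.C) (Q.map Polynomial.C) := by
  rw [← comap_mapRingHom_map_C, ← comap_mapRingHom_map_C]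
  have := (Ideal.isPrime_map_C_iff_isPrime _).2 hQ
  have := Polynomial.isLocalization S B
  let := (Polynomial.mapRingHom (algebraMap A B)).toAlgebra
  exact adjacentFor_comap_algebraMap_iff (S.map Polynomial.C)

theorem IsStrongSDomain.of_isNoetherianRing [IsNoetherianRing A] : IsStrongSDomain A := by
  refine isStrongSDomain_iff.2 fun P Q hP hQ hPQ ↦ ?_
  have hmem (I : Ideal A) (J : Ideal (Polynomial A)) :
      I.map Polynomial.C ≤ J ↔ I ≤ J.comap Polynomial.C := Ideal.map_le_iff_le_comap
  have hcomap (I : Ideal A) : (I.map Polynomial.C).comap Polynomial.C = I := by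
    ext a
    refine ⟨fun h ↦ ?_, fun h ↦ Ideal.mem_map_of_mem _ h⟩
    simpa using Ideal.mem_map_C_iff.1 h 0
  have hle : P.map (Polynomial.C : A →+* Polynomial A) ≤ Q.map Polynomial.C :=
    Ideal.map_mono hPQ.1.le
  refine ⟨lt_of_le_not_ge hle fun h ↦ hPQ.1.not_ge ?_, fun I hI hlt ↦ ?_⟩
  · simpa only [hcomap] using Ideal.comap_mono (f := Polynomial.C) h
  have hP' := (Ideal.isPrime_map_C_iff_isPrime _).2 hP
  have hQ' := (Ideal.isPrime_map_C_iff_isPrime _).2 hQ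
  obtain ⟨a, haQ, haP⟩ := SetLike.exists_of_lt hPQ.1
  have hmin : Q.map Polynomial.C ∈
      (P.map Polynomial.C ⊔ Ideal.span {Polynomial.C a}).minimalPrimes := by
    refine ⟨⟨hQ', sup_le hle ?_⟩, fun J ⟨hJ, hJle⟩ hJQ ↦ ?_⟩
    · exact (Ideal.span_singleton_le_iff_mem _).2 (Ideal.mem_map_of_mem _ haQ)
    · have hPJ := (hmem _ _).1 (le_sup_left.trans hJle)
      have haJ : a ∈ J.comap Polynomial.C :=
        (Ideal.span_singleton_le_iff_mem J).1 (le_sup_right.trans hJle)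
      have hJQ' : J.comap Polynomial.C ≤ Q := by
        simpa only [hcomap] using Ideal.comap_mono (f := Polynomial.C) hJQ
      refine (hmem _ _).2 (not_lt_iff_le_imp_ge.1 (fun h ↦ ?_) hJQ')
      exact hPQ.2 _ (hJ.comap _) ⟨lt_of_le_not_ge hPJ fun h' ↦ haP (h' haJ), h⟩
  have hht := Ideal.map_height_le_one_of_mem_minimalPrimes hmin
  have hs := Ideal.Quotient.mk_surjective (I := P.map (Polynomial.C : A →+* Polynomial A))
  have hlt_map {J K : Ideal (Polynomial A)} (hJ : P.map Polynomial.C ≤ J)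
      (hK : P.map Polynomial.C ≤ K) (h : J < K) :
      J.map (Ideal.Quotient.mk (P.map Polynomial.C)) <
        K.map (Ideal.Quotient.mk (P.map Polynomial.C)) := by
    refine lt_of_le_not_ge (Ideal.map_mono h.le) fun h' ↦ h.not_ge ?_
    have := Ideal.comap_mono (f := Ideal.Quotient.mk (P.map Polynomial.C)) h'
    simpa only [Ideal.comap_map_quotientMk, sup_eq_right.2 hJ, sup_eq_right.2 hK] using this
  have hprime {J : Ideal (Polynomial A)} (hJ : P.map Polynomial.C ≤ J) (h : J.IsPrime) :
      (J.map (Ideal.Quotient.mk (P.map Polynomial.C))).IsPrime :=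
    Ideal.map_isPrime_of_surjective hs (by rwa [Ideal.mk_ker])
  have := hprime le_rfl hP'
  have := hprime hlt.1.le hI
  have := hprime hle hQ'
  have h₁ := Ideal.height_add_one_le_of_lt_of_isPrime (hlt_map le_rfl hlt.1.le hlt.1)
  have h₂ := Ideal.height_add_one_le_of_lt_of_isPrime (hlt_map hlt.1.le hle hlt.2)
  have h₃ : (0 + 1 + 1 : ℕ∞) ≤ 1 :=
    (add_le_add_left ((add_le_add_left zero_le 1).trans h₁) 1).trans (h₂.trans hht)
  exact absurd h₃ (by decide)

end AdjacentPrimes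

section PolynomialRings

attribute [local instance] MvPolynomial.algebraMvPolynomial

variable (R : Type*) [CommRing R] (n : ℕ)

/-- `R[X₁,…,Xₙ₊₁]` as polynomials in the last variable over `R[X₁,…,Xₙ]`. -/
noncomputable def mvPolynomialLastEquiv :
    MvPolynomial (Fin (n + 1)) R ≃ₐ[R] Polynomial (MvPolynomial (Fin n) R) :=
  (MvPolynomial.renameEquiv R finSuccEquivLast).trans (MvPolynomial.optionEquivLeft R (Fin n))

theorem mvPolynomialLastEquiv_rename_castSucc (p : MvPolynomial (Fin n) R) :
    mvPolynomialLastEquiv R n (MvPolynomial.rename Fin.castSucc p) = Polynomial.C p := by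
  induction p using MvPolynomial.induction_on with
  | C a => simp [mvPolynomialLastEquiv]
  | add p q hp hq => simp only [map_add, hp, hq]
  | mul_X p i hp =>
    rw [map_mul, map_mul, hp]
    simp [mvPolynomialLastEquiv]

variable {R n}

theorem map_rename_castSucc_eq_comap (I : Ideal (MvPolynomial (Fin n) R)) :
    I.map (MvPolynomial.rename (Fin.castSucc : Fin n → Fin (n + 1))).toRingHom =
      (I.map Polynomial.C).comap (mvPolynomialLastEquiv R n).toRingEquiv.toRingHom := by
  have h : (Polynomial.C : MvPolynomial (Fin n) R →+* _) =
      (mvPolynomialLastEquiv R n).toRingEquiv.toRingHom.comp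
        (MvPolynomial.rename (Fin.castSucc : Fin n → Fin (n + 1))).toRingHom :=
    RingHom.ext fun p ↦ (mvPolynomialLastEquiv_rename_castSucc R n p).symm
  rw [h, ← Ideal.map_map]
  exact (Ideal.comap_map_of_bijective _ (mvPolynomialLastEquiv R n).bijective).symm

theorem adjacentFor_map_rename_castSucc_iff {P Q : Ideal (MvPolynomial (Fin n) R)} :
    AdjacentFor Ideal.IsPrime
        (P.map (MvPolynomial.rename (Fin.castSucc : Fin n → Fin (n + 1))).toRingHom)
        (Q.map (MvPolynomial.rename (Fin.castSucc : Fin n → Fin (n + 1))).toRingHom) ↔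
      AdjacentFor Ideal.IsPrime (P.map Polynomial.C) (Q.map Polynomial.C) := by
  rw [map_rename_castSucc_eq_comap, map_rename_castSucc_eq_comap]
  exact adjacentFor_comap_iff_of_surjective (mvPolynomialLastEquiv R n).surjective

theorem comap_algebraMap_map_rename_castSucc (I : Ideal (MvPolynomial (Fin n) R)) :
    (I.map (MvPolynomial.rename (Fin.castSucc : Fin n → Fin (n + 1))).toRingHom).comap
      (algebraMap R _) = I.comap (algebraMap R _) := by
  rw [map_rename_castSucc_eq_comap]
  ext r
  have h : (mvPolynomialLastEquiv R n).toRingEquiv.toRingHom (algebraMap R _ r) =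
      Polynomial.C (algebraMap R (MvPolynomial (Fin n) R) r) :=
    (mvPolynomialLastEquiv R n).commutes r
  rw [Ideal.mem_comap, Ideal.mem_comap, h, Ideal.mem_map_C_iff, Ideal.mem_comap]
  refine ⟨fun H ↦ by simpa using H 0, fun H k ↦ ?_⟩
  rw [Polynomial.coeff_C]
  split_ifs
  exacts [H, I.zero_mem]

theorem isPrime_map_rename_castSucc {I : Ideal (MvPolynomial (Fin n) R)} (hI : I.IsPrime) :
    (I.map (MvPolynomial.rename (Fin.castSucc : Fin n → Fin (n + 1))).toRingHom).IsPrime := by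
  rw [map_rename_castSucc_eq_comap]
  exact ((Ideal.isPrime_map_C_iff_isPrime _).2 hI).comap _

variable (R n)

/-- The surjection `R[X₁,…,Xₙ₊₁] → R[X₁,…,Xₙ]` killing the last variable. -/
noncomputable def mvPolynomialKillLast :
    MvPolynomial (Fin (n + 1)) R →ₐ[R] MvPolynomial (Fin n) R :=
  MvPolynomial.aeval (Fin.lastCases 0 MvPolynomial.X)

theorem mvPolynomialKillLast_surjective : Function.Surjective (mvPolynomialKillLast R n) := by
  intro p
  refine ⟨MvPolynomial.rename Fin.castSucc p, ?_⟩
  rw [mvPolynomialKillLast, MvPolynomial.aeval_rename]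
  convert MvPolynomial.aeval_X_left_apply p using 2
  congr 1
  ext1 i
  simp

variable {R n}

theorem comap_mvPolynomialKillLast_ne_bot [Nontrivial R] (Q : Ideal (MvPolynomial (Fin n) R)) :
    Q.comap (mvPolynomialKillLast R n).toRingHom ≠ ⊥ := by
  refine (Submodule.ne_bot_iff _).2 ⟨MvPolynomial.X (Fin.last n), ?_, MvPolynomial.X_ne_zero _⟩
  have h : (mvPolynomialKillLast R n).toRingHom (MvPolynomial.X (Fin.last n)) = 0 := by
    simp [mvPolynomialKillLast]
  rw [Ideal.mem_comap, h]
  exact Q.zero_mem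

/-- Adjacency of extensions to `R[X₁,…,Xₙ][X]` descends from a localization of `R`. -/
theorem adjacentFor_map_C_of_isLocalization {S : Type*} [CommRing S] [Algebra R S]
    (M : Submonoid R) [IsLocalization M S] (hS : IsStrongSDomain (MvPolynomial (Fin n) S))
    {P Q : Ideal (MvPolynomial (Fin n) R)} (hP : P.IsPrime) (hQ : Q.IsPrime)
    (hd : Disjoint (M : Set R) (Q.comap (algebraMap R (MvPolynomial (Fin n) R))))
    (hPQ : AdjacentFor Ideal.IsPrime P Q) :
    AdjacentFor Ideal.IsPrime (P.map Polynomial.C) (Q.map Polynomial.C) := by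
  let N : Submonoid (MvPolynomial (Fin n) R) := M.map MvPolynomial.C
  have hdQ : Disjoint (N : Set (MvPolynomial (Fin n) R)) Q := by
    rw [Set.disjoint_left]
    rintro _ ⟨m, hm, rfl⟩ h
    exact Set.disjoint_left.1 hd hm h
  have hdP : Disjoint (N : Set (MvPolynomial (Fin n) R)) P := hdQ.mono_right hPQ.1.le
  have hP' := IsLocalization.isPrime_of_isPrime_disjoint N (MvPolynomial (Fin n) S) P hP hdP
  have hQ' := IsLocalization.isPrime_of_isPrime_disjoint N (MvPolynomial (Fin n) S) Q hQ hdQ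
  have eP : (P.map (algebraMap _ (MvPolynomial (Fin n) S))).comap (algebraMap _ _) = P :=
    IsLocalization.under_map_of_isPrime_disjoint N _ hP hdP
  have eQ : (Q.map (algebraMap _ (MvPolynomial (Fin n) S))).comap (algebraMap _ _) = Q :=
    IsLocalization.under_map_of_isPrime_disjoint N _ hQ hdQ
  rw [← eP, ← eQ, adjacentFor_comap_algebraMap_iff N] at hPQ
  rw [← eP, ← eQ, adjacentFor_map_C_comap_algebraMap_iff N]
  exact isStrongSDomain_iff.1 hS _ _ hP' hQ' hPQ

end PolynomialRings

section SemistarIdeals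

variable {R F : Type*} [CommRing R] [Field F] [Algebra R F] (s : SemistarOp R F)

theorem SemistarOp.ft_mono {E E' : Submodule R F} (h : E ≤ E') : s.ft E ≤ s.ft E' :=
  iSup₂_le fun G hG ↦ le_iSup₂_of_le G ⟨hG.1, hG.2.1, hG.2.2.trans h⟩ le_rfl

theorem SemistarOp.star_le_ft {E G : Submodule R F} (hG : G.FG) (hG0 : G ≠ ⊥) (h : G ≤ E) :
    s.star G ≤ s.ft E :=
  le_iSup₂_of_le G ⟨hG, hG0, h⟩ le_rfl

theorem SemistarOp.ft_bot : s.ft ⊥ = ⊥ :=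
  eq_bot_iff.2 <| iSup₂_le fun _ hG ↦ absurd (le_bot_iff.1 hG.2.2) hG.2.1

theorem SemistarOp.mem_ft {E : Submodule R F} {x : F} (hx : x ∈ s.ft E) (hx0 : x ≠ 0) :
    ∃ G : Submodule R F, G.FG ∧ G ≠ ⊥ ∧ G ≤ E ∧ x ∈ s.star G := by
  let T := {G : Submodule R F // G.FG ∧ G ≠ ⊥ ∧ G ≤ E}
  have hsup : s.ft E = ⨆ G : T, s.star G.1 := iSup_subtype'
  rw [hsup] at hx
  rcases isEmpty_or_nonempty T with hT | hT
  · rw [iSup_of_empty] at hx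
    exact absurd ((Submodule.mem_bot R).1 hx) hx0
  have hdir : Directed (· ≤ ·) fun G : T ↦ s.star G.1 := by
    rintro ⟨G, hG, hG0, hGE⟩ ⟨H, hH, hH0, hHE⟩
    have h0 : G ⊔ H ≠ ⊥ := fun h ↦ hG0 (le_bot_iff.1 (h ▸ le_sup_left))
    exact ⟨⟨G ⊔ H, hG.sup hH, h0, sup_le hGE hHE⟩, s.star_mono _ _ hG0 h0 le_sup_left,
      s.star_mono _ _ hH0 h0 le_sup_right⟩
  obtain ⟨⟨G, hG, hG0, hGE⟩, hxG⟩ := (Submodule.mem_iSup_of_directed _ hdir).1 hx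
  exact ⟨G, hG, hG0, hGE, hxG⟩

theorem SemistarOp.le_ft (E : Submodule R F) : E ≤ s.ft E := by
  intro x hx
  rcases eq_or_ne x 0 with rfl | hx0
  · exact Submodule.zero_mem _
  have h0 : Submodule.span R {x} ≠ ⊥ := by simpa using hx0
  exact s.star_le_ft (Submodule.fg_span_singleton x) h0
    ((Submodule.span_singleton_le_iff_mem _ _).2 hx)
    (s.le_star _ h0 (Submodule.mem_span_singleton_self x))

theorem SemistarOp.exists_fg_le_star {E G : Submodule R F} (hG : G.FG) (hG0 : G ≠ ⊥)
    (h : G ≤ s.ft E) : ∃ H : Submodule R F, H.FG ∧ H ≠ ⊥ ∧ H ≤ E ∧ G ≤ s.star H := by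
  induction G, hG using Submodule.fg_induction with
  | singleton x =>
    have hx0 : x ≠ 0 := by simpa using hG0
    obtain ⟨H, h₁, h₂, h₃, h₄⟩ := s.mem_ft (h (Submodule.mem_span_singleton_self x)) hx0
    exact ⟨H, h₁, h₂, h₃, (Submodule.span_singleton_le_iff_mem _ _).2 h₄⟩
  | sup G₁ G₂ _ _ ih₁ ih₂ =>
    rcases eq_or_ne G₁ ⊥ with rfl | hne₁
    · rw [bot_sup_eq] at *
      exact ih₂ hG0 h
    rcases eq_or_ne G₂ ⊥ with rfl | hne₂
    · rw [sup_bot_eq] at *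
      exact ih₁ hG0 h
    obtain ⟨H₁, a₁, b₁, c₁, d₁⟩ := ih₁ hne₁ (le_sup_left.trans h)
    obtain ⟨H₂, a₂, b₂, c₂, d₂⟩ := ih₂ hne₂ (le_sup_right.trans h)
    have h0 : H₁ ⊔ H₂ ≠ ⊥ := fun h ↦ b₁ (le_bot_iff.1 (h ▸ le_sup_left))
    exact ⟨H₁ ⊔ H₂, a₁.sup a₂, h0, sup_le c₁ c₂,
      sup_le (d₁.trans (s.star_mono _ _ b₁ h0 le_sup_left))
        (d₂.trans (s.star_mono _ _ b₂ h0 le_sup_right))⟩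

theorem SemistarOp.ft_ft (E : Submodule R F) : s.ft (s.ft E) ≤ s.ft E := by
  refine iSup₂_le fun G ⟨hG, hG0, hGE⟩ ↦ ?_
  obtain ⟨H, hH, hH0, hHE, hGH⟩ := s.exists_fg_le_star hG hG0 hGE
  have hs0 : s.star H ≠ ⊥ := fun h ↦ hG0 (le_bot_iff.1 (h ▸ hGH))
  calc s.star G ≤ s.star (s.star H) := s.star_mono _ _ hG0 hs0 hGH
    _ = s.star H := s.star_idem _ hH0
    _ ≤ s.ft E := s.star_le_ft hH hH0 hHE

theorem idealExt_mono {I J : Ideal R} (h : I ≤ J) : (idealExt I : Submodule R F) ≤ idealExt J :=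
  Submodule.map_mono h

theorem idealExt_idealCon_le (E : Submodule R F) : idealExt (idealCon E) ≤ E :=
  Submodule.map_comap_le _ _

theorem mem_idealCon {E : Submodule R F} {a : R} : a ∈ idealCon E ↔ algebraMap R F a ∈ E := Iff.rfl

theorem idealCon_eq_top_iff {E : Submodule R F} : idealCon E = ⊤ ↔ (1 : F) ∈ E := by
  rw [Ideal.eq_top_iff_one, mem_idealCon, map_one]

theorem one_mem_idealExt_top : (1 : F) ∈ (idealExt ⊤ : Submodule R F) :=
  ⟨1, trivial, map_one (algebraMap R F)⟩

theorem idealExt_top_ne_bot : (idealExt ⊤ : Submodule R F) ≠ ⊥ := fun h ↦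
  one_ne_zero ((Submodule.mem_bot R).1 (h ▸ one_mem_idealExt_top (R := R) (F := F)))

theorem idealExt_top_le {E : Submodule R F} (h : (1 : F) ∈ E) : idealExt ⊤ ≤ E := by
  rintro _ ⟨a, -, rfl⟩
  have := E.smul_mem a h
  rwa [Algebra.smul_def, mul_one] at this

theorem SemistarOp.ft_idealExt_eq_star_top_iff (I : Ideal R) :
    s.ft (idealExt I) = s.star (idealExt (⊤ : Ideal R)) ↔ (1 : F) ∈ s.ft (idealExt I) := by
  refine ⟨fun h ↦ h ▸ s.le_star _ idealExt_top_ne_bot one_mem_idealExt_top, fun h ↦ ?_⟩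
  apply le_antisymm
  · exact iSup₂_le fun G ⟨_, hG0, hGI⟩ ↦
      s.star_mono _ _ hG0 idealExt_top_ne_bot (hGI.trans (idealExt_mono le_top))
  · obtain ⟨G, hG, hG0, hGI, h1⟩ := s.mem_ft h one_ne_zero
    have hle := idealExt_top_le h1
    calc s.star (idealExt ⊤) ≤ s.star (s.star G) :=
          s.star_mono _ _ idealExt_top_ne_bot
            (fun h ↦ idealExt_top_ne_bot (le_bot_iff.1 (h ▸ hle))) hle
      _ = s.star G := s.star_idem _ hG0
      _ ≤ s.ft (idealExt I) := s.star_le_ft hG hG0 hGI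

theorem quasiPolyPrime_iff {n : ℕ} {Q : Ideal (MvPolynomial (Fin n) R)} :
    QuasiPolyPrime s n Q ↔
      Q ≠ ⊥ ∧ Q.IsPrime ∧ (1 : F) ∉ s.ft (idealExt (Q.comap (algebraMap R _))) := by
  refine and_congr_right fun _ ↦ and_congr_right fun _ ↦ ?_
  rw [Ne, s.ft_idealExt_eq_star_top_iff, or_iff_right_of_imp]
  intro h
  rw [h, idealExt, Submodule.map_bot, s.ft_bot]
  simp

theorem QuasiPolyPrime.of_le {n : ℕ} {I Q : Ideal (MvPolynomial (Fin n) R)}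
    (hQ : QuasiPolyPrime s n Q) (hI : I.IsPrime) (hI0 : I ≠ ⊥) (h : I ≤ Q) :
    QuasiPolyPrime s n I := by
  rw [quasiPolyPrime_iff] at hQ ⊢
  exact ⟨hI0, hI, fun h1 ↦ hQ.2.2 (s.ft_mono (idealExt_mono (Ideal.comap_mono h)) h1)⟩

theorem QuasiPolyPrime.adjacentFor_iff {n : ℕ} {P Q : Ideal (MvPolynomial (Fin n) R)}
    (hQ : QuasiPolyPrime s n Q) :
    AdjacentFor (QuasiPolyPrime s n) P Q ↔ AdjacentFor Ideal.IsPrime P Q :=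
  and_congr_right fun _ ↦ forall_congr' fun _ ↦
    ⟨fun h hI hlt ↦ h (hQ.of_le s hI (bot_le.trans_lt hlt.1).ne' hlt.2.le) hlt,
      fun h hI hlt ↦ h hI.2.1 hlt⟩

theorem QuasiPolyPrime.map_rename_castSucc {n : ℕ} {Q : Ideal (MvPolynomial (Fin n) R)}
    (hQ : QuasiPolyPrime s n Q) :
    QuasiPolyPrime s (n + 1)
      (Q.map (MvPolynomial.rename (Fin.castSucc : Fin n → Fin (n + 1))).toRingHom) := by
  rw [quasiPolyPrime_iff] at hQ ⊢
  refine ⟨fun h ↦ hQ.1 ?_, isPrime_map_rename_castSucc hQ.2.1, ?_⟩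
  · exact (Ideal.map_eq_bot_iff_of_injective
      (MvPolynomial.rename_injective _ (Fin.castSucc_injective n))).1 h
  · rw [comap_algebraMap_map_rename_castSucc]
    exact hQ.2.2

theorem polyStrongSDomain_iff {n : ℕ} :
    PolyStrongSDomain s n ↔ ∀ P Q : Ideal (MvPolynomial (Fin n) R),
      QuasiPolyPrime s n P → QuasiPolyPrime s n Q → AdjacentFor Ideal.IsPrime P Q →
        AdjacentFor Ideal.IsPrime (P.map Polynomial.C) (Q.map Polynomial.C) := by
  refine forall₂_congr fun P Q ↦ forall₂_congr fun hP hQ ↦ ?_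
  rw [hQ.adjacentFor_iff s, (hQ.map_rename_castSucc s).adjacentFor_iff s,
    adjacentFor_map_rename_castSucc_iff]
  exact imp_congr_right fun _ ↦
    ⟨fun h ↦ h.2.2, fun h ↦ ⟨hP.map_rename_castSucc s, hQ.map_rename_castSucc s, h⟩⟩

theorem idealCon_ft_idealExt (I : Ideal R) : I ≤ idealCon (s.ft (idealExt I)) :=
  fun a ha ↦ s.le_ft _ ⟨a, ha, rfl⟩

theorem IsQuasiMax.one_notMem_ft {M I : Ideal R} (hM : IsQuasiMax s.ft M) (h : I ≤ M) :
    (1 : F) ∉ s.ft (idealExt I) := fun h1 ↦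
  hM.2.1 (hM.1.2 ▸ idealCon_eq_top_iff.2 (s.ft_mono (idealExt_mono h) h1))

/-- If `I^{⋆_f}` does not contain `1`, then `I` is contained in a prime quasi-`⋆_f`-maximal
ideal. -/
theorem SemistarOp.exists_isQuasiMax [FaithfulSMul R F] {I : Ideal R} (hI : I ≠ ⊥)
    (h1 : (1 : F) ∉ s.ft (idealExt I)) :
    ∃ M : Ideal R, IsQuasiMax s.ft M ∧ M.IsPrime ∧ I ≤ M := by
  obtain ⟨M, hIM, hM⟩ := zorn_le_nonempty₀ {J : Ideal R | (1 : F) ∉ s.ft (idealExt J)}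
    (fun c hc hchain y hy ↦ by
      refine ⟨sSup c, fun hmem ↦ ?_, fun z hz ↦ le_sSup hz⟩
      obtain ⟨G, hG, hG0, hGc, hG1⟩ := s.mem_ft hmem one_ne_zero
      have hsup : (idealExt (sSup c) : Submodule R F) = sSup (idealExt '' c) := by
        rw [idealExt, sSup_eq_iSup, sSup_image]
        simp only [Submodule.map_iSup]
        rfl
      rw [hsup] at hGc
      have hdir : DirectedOn (· ≤ ·) ((idealExt : Ideal R → Submodule R F) '' c) := by
        rintro _ ⟨J, hJ, rfl⟩ _ ⟨K, hK, rfl⟩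
        rcases hchain.total hJ hK with h | h
        exacts [⟨_, ⟨K, hK, rfl⟩, idealExt_mono h, le_rfl⟩,
          ⟨_, ⟨J, hJ, rfl⟩, le_rfl, idealExt_mono h⟩]
      obtain ⟨_, ⟨J, hJ, rfl⟩, hGJ⟩ :=
        (CompleteLattice.isCompactElement_iff_le_of_directed_sSup_le _ G).1
          ((Submodule.fg_iff_compact G).1 hG) _ ⟨_, Set.mem_image_of_mem _ hy⟩ hdir hGc
      exact hc hJ (s.star_le_ft hG hG0 hGJ hG1)) I h1
  have hM1 : (1 : F) ∉ s.ft (idealExt M) := hM.1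
  have hcon : idealCon (s.ft (idealExt M)) = M := by
    refine le_antisymm (hM.2 (fun h ↦ hM1 ?_) (idealCon_ft_idealExt s M))
      (idealCon_ft_idealExt s M)
    exact s.ft_ft _ (s.ft_mono (idealExt_idealCon_le _) h)
  have hM0 : M ≠ ⊥ := fun h ↦ hI (le_bot_iff.1 (h ▸ hIM))
  have hMtop : M ≠ ⊤ := fun h ↦ hM1 (idealCon_eq_top_iff.1 (hcon.trans h))
  refine ⟨M, ⟨⟨hM0, hcon⟩, hMtop, fun J hJ hJtop hMJ ↦ le_antisymm hMJ (hM.2 ?_ hMJ)⟩,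
    ⟨hMtop, fun {a b} hab ↦ or_iff_not_imp_left.2 fun ha ↦ ?_⟩, hIM⟩
  · exact fun h ↦ hJtop (hJ.2.symm.trans (idealCon_eq_top_iff.2 h))
  · rcases eq_or_ne b 0 with rfl | hb
    · exact M.zero_mem
    have hb' : algebraMap R F b ≠ 0 := by simpa using hb
    have hnot : (1 : F) ∈ s.ft (idealExt (M ⊔ Ideal.span {a})) := by
      by_contra h
      exact ha (hM.2 h le_sup_left
        (Ideal.mem_sup_right (Ideal.mem_span_singleton_self a)))
    obtain ⟨G, hG, hG0, hGM, hG1⟩ := s.mem_ft hnot one_ne_zero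
    have hbG : algebraMap R F b • G ≤ idealExt M := by
      rintro _ ⟨x, hx, rfl⟩
      obtain ⟨y, hy, rfl⟩ := hGM hx
      refine ⟨b * y, ?_, by simp⟩
      obtain ⟨m, hm, z, hz, rfl⟩ := Submodule.mem_sup.1 hy
      obtain ⟨c, rfl⟩ := Ideal.mem_span_singleton'.1 hz
      have : b * (m + c * a) = b * m + c * (a * b) := by ring
      rw [this]
      exact M.add_mem (M.mul_mem_left _ hm) (M.mul_mem_left _ hab)
    have hbG0 : algebraMap R F b • G ≠ ⊥ := by
      obtain ⟨x, hx, hx0⟩ := (Submodule.ne_bot_iff _).1 hG0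
      exact (Submodule.ne_bot_iff _).2 ⟨_, Submodule.smul_mem_pointwise_smul _ _ _ hx,
        smul_ne_zero hb' hx0⟩
    rw [← hcon, mem_idealCon]
    have hbGfg : (algebraMap R F b • G).FG := hG.map _
    refine s.star_le_ft hbGfg hbG0 hbG ?_
    rw [s.star_smul _ hb' _ hG0]
    simpa using Submodule.smul_mem_pointwise_smul _ (algebraMap R F b) _ hG1

theorem IsQuasiIdeal.exists_isQuasiMax_ft_ge [FaithfulSMul R F] {I : Ideal R}
    (hI : IsQuasiIdeal s.tilde I) (hI1 : I ≠ ⊤) :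
    ∃ M : Ideal R, IsQuasiMax s.ft M ∧ M.IsPrime ∧ I ≤ M := by
  have h1 : (1 : F) ∉ s.tilde (idealExt I) := fun h ↦
    hI1 (hI.2.symm.trans (idealCon_eq_top_iff.2 h))
  have h1' : ¬ ∀ M : Ideal R, IsQuasiMax s.ft M → M.IsPrime →
    ∃ d : R, d ∉ M ∧ d • (1 : F) ∈ (idealExt I : Submodule R F) := h1
  push Not at h1'
  obtain ⟨M, hM, hMp, h⟩ := h1'
  refine ⟨M, hM, hMp, fun a ha ↦ by_contra fun haM ↦ h a haM ⟨a, ha, ?_⟩⟩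
  simp [Algebra.smul_def]

theorem IsQuasiMax.tilde [FaithfulSMul R F] {M : Ideal R} (hM : IsQuasiMax s.ft M)
    (hMp : M.IsPrime) : IsQuasiMax s.tilde M := by
  refine ⟨⟨hM.1.1, le_antisymm (fun a ha ↦ ?_) fun a ha P _ hP ↦ ?_⟩, hM.2.1,
    fun J hJ hJ1 hMJ ↦ ?_⟩
  · obtain ⟨d, hd, b, hb, hbd⟩ := (mem_idealCon.1 ha : _ ∈ s.tilde _) M hM hMp
    have : b = d * a := FaithfulSMul.algebraMap_injective R F (by
      simpa [Algebra.smul_def] using hbd)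
    exact (hMp.mem_or_mem (this ▸ hb)).resolve_left hd
  · refine ⟨1, hP.one_notMem, ?_⟩
    rw [one_smul]
    exact ⟨a, ha, rfl⟩
  · obtain ⟨M', hM', -, hJM'⟩ := hJ.exists_isQuasiMax_ft_ge s hJ1
    have := hM.2.2 M' hM'.1 hM'.2.1 (hMJ.trans hJM')
    exact le_antisymm hMJ (this ▸ hJM')

end SemistarIdeals

section Localization

attribute [local instance] MvPolynomial.algebraMvPolynomial

theorem isStablyStrongSDomain_localization {D F : Type*} [CommRing D] [IsDomain D] [Field F]
    [Algebra D F] [FaithfulSMul D F] (s : SemistarOp D F) (h : TildeStablyStrongSDomain s)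
    (P : Ideal D) [hP : P.IsPrime] (hPq : IsQuasiIdeal s.tilde P) :
    IsStablyStrongSDomain (Localization.AtPrime P) := by
  obtain ⟨M, hM, -, hPM⟩ := hPq.exists_isQuasiMax_ft_ge s hP.ne_top
  intro n _
  refine isStrongSDomain_iff.2 fun p q hp hq hpq ↦ ?_
  let N : Submonoid (MvPolynomial (Fin n) D) := P.primeCompl.map MvPolynomial.C
  let f := algebraMap (MvPolynomial (Fin n) D) (MvPolynomial (Fin n) (Localization.AtPrime P))
  let g := (mvPolynomialKillLast D n).toRingHom
  have hg : Function.Surjective g := mvPolynomialKillLast_surjective D n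
  have hqP : (q.comap f).comap (algebraMap D _) ≤ P := by
    intro a ha
    by_contra haP
    have hd := ((IsLocalization.isPrime_iff_isPrime_disjoint N _ q).1 hq).2
    exact Set.disjoint_left.1 hd ⟨a, haP, rfl⟩ ha
  have hcon (J : Ideal (MvPolynomial (Fin n) D)) :
      (J.comap g).comap (algebraMap D _) = J.comap (algebraMap D _) := by
    ext a
    have : g (algebraMap D _ a) = algebraMap D _ a := (mvPolynomialKillLast D n).commutes a
    simp only [Ideal.mem_comap, this]
  have hquasi : QuasiPolyPrime s (n + 1) ((q.comap f).comap g) := by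
    refine (quasiPolyPrime_iff s).2
      ⟨comap_mvPolynomialKillLast_ne_bot _, (hq.comap f).comap g, ?_⟩
    rw [hcon]
    exact hM.one_notMem_ft s (hqP.trans hPM)
  have hquasi' : QuasiPolyPrime s (n + 1) ((p.comap f).comap g) :=
    hquasi.of_le s ((hp.comap f).comap g) (comap_mvPolynomialKillLast_ne_bot _)
      (Ideal.comap_mono (Ideal.comap_mono hpq.1.le))
  rw [← adjacentFor_map_C_comap_algebraMap_iff N, ← adjacentFor_map_C_comap_iff_of_surjective hg]
  refine (polyStrongSDomain_iff s).1 (h (n + 1) (by omega)) _ _ hquasi' hquasi ?_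
  rw [adjacentFor_comap_iff_of_surjective hg]
  exact (adjacentFor_comap_algebraMap_iff N).2 hpq

theorem tildeStablyStrongSDomain_of_localization {D F : Type*} [CommRing D] [IsDomain D] [Field F]
    [Algebra D F] [FaithfulSMul D F] (s : SemistarOp D F)
    (h : ∀ (M : Ideal D) [M.IsPrime], IsQuasiMax s.tilde M →
      IsStablyStrongSDomain (Localization.AtPrime M)) :
    TildeStablyStrongSDomain s := by
  intro n hn
  refine (polyStrongSDomain_iff s).2 fun P Q hP hQ hPQ ↦ ?_
  rw [quasiPolyPrime_iff] at hP hQ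
  rcases eq_or_ne (Q.comap (algebraMap D (MvPolynomial (Fin n) D))) ⊥ with h0 | h0
  · refine adjacentFor_map_C_of_isLocalization (S := FractionRing D) (nonZeroDivisors D)
      IsStrongSDomain.of_isNoetherianRing hP.2.1 hQ.2.1 ?_ hPQ
    rw [h0, Set.disjoint_left]
    exact fun a ha ha0 ↦ nonZeroDivisors.ne_zero ha ((Submodule.mem_bot D).1 ha0)
  · obtain ⟨M, hM, hMp, hQM⟩ := s.exists_isQuasiMax h0 hQ.2.2
    refine adjacentFor_map_C_of_isLocalization (S := Localization.AtPrime M) M.primeCompl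
      (h M (hM.tilde s hMp) n hn) hP.2.1 hQ.2.1 ?_ hPQ
    exact Set.disjoint_left.2 fun a ha haQ ↦ ha (hQM haQ)

end Localization

/-- `D` is a `⋆̃`-stably strong S-domain iff `D_P` is a stably strong
S-domain for every quasi-`⋆̃`-prime `P` iff `D_M` is a stably strong S-domain for every
quasi-`⋆̃`-maximal `M`. -/
theorem tildeStablyStrongSDomain_tfae (D : Type*) [CommRing D] [IsDomain D]
    (s : SemistarOp D (FractionRing D)) :
    [TildeStablyStrongSDomain s,
     ∀ (P : Ideal D) [P.IsPrime], IsQuasiIdeal s.tilde P →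
       IsStablyStrongSDomain (Localization.AtPrime P),
     ∀ (M : Ideal D) [M.IsPrime], IsQuasiMax s.tilde M →
       IsStablyStrongSDomain (Localization.AtPrime M)].TFAE := by
  tfae_have 1 → 2 := fun h P _ hP ↦ isStablyStrongSDomain_localization s h P hP
  tfae_have 2 → 3 := fun h M _ hM ↦ h M hM.1
  tfae_have 3 → 1 := fun h ↦ tildeStablyStrongSDomain_of_localization s h
  tfae_finish
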